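/- Let K ⊆ ℝ² be a self-dual convex body with finitely many boundary segments, at least one, and no non-exposed points. Then K is a polytope and the number of its segments (equivalently, of its vertices) is odd, and at least 3. -/

import Mathlib

open RealInnerProductSpace Set
open scoped ENNReal

noncomputable section

abbrev Eu (n : ℕ) := EuclideanSpace ℝ (Fin n)

/-- The dual of a set: `C* = {u | 1 + ⟪u,v⟫ ≥ 0 for all v ∈ C}`. -/
def dualSet {n : ℕ} (C : Set (Eu n)) : Set (Eu n) := {u | ∀ v ∈ C, 0 ≤ 1 + ⟪u, v⟫}

/-- The polar of a set: `C° = {u | ⟪u,v⟫ ≤ 1 for all v ∈ C}`. -/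
def polarSet {n : ℕ} (C : Set (Eu n)) : Set (Eu n) := {u | ∀ v ∈ C, ⟪u, v⟫ ≤ 1}

/-- The support function `h_C(u) = sup {⟪x,u⟫ | x ∈ C}`. -/
def supp {n : ℕ} (C : Set (Eu n)) (u : Eu n) : ℝ := sSup ((fun x => ⟪x, u⟫) '' C)

/-- The radial function `ρ_K(u) = sup {λ ≥ 0 | λ • u ∈ K}`. -/
def radial {n : ℕ} (K : Set (Eu n)) (u : Eu n) : ℝ := sSup {l : ℝ | 0 ≤ l ∧ l • u ∈ K}

/-- The normal cone of `C` at `x`. -/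
def normalCone {n : ℕ} (C : Set (Eu n)) (x : Eu n) : Set (Eu n) :=
  {u | ∀ y ∈ C, ⟪u, y - x⟫ ≤ 0}

/-- `F` is a face of the convex set `C`. -/
def IsFace {n : ℕ} (C F : Set (Eu n)) : Prop :=
  F ⊆ C ∧ Convex ℝ F ∧ ∀ x ∈ C, ∀ z ∈ C, ∀ y ∈ F, y ∈ openSegment ℝ x z → x ∈ F ∧ z ∈ F

/-- `F` is an exposed face of `C`: it is `∅`, `C`, or `C ∩ H_C(u)` for some nonzero `u`. -/
def IsExposedFace {n : ℕ} (C F : Set (Eu n)) : Prop :=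
  F = ∅ ∨ F = C ∨ ∃ u : Eu n, u ≠ 0 ∧ F = {x ∈ C | ⟪x, u⟫ = supp C u}

/-- The conjugate face of a subset `F` of `C`, inside the polar body. -/
def conjFace {n : ℕ} (C F : Set (Eu n)) : Set (Eu n) :=
  {v ∈ polarSet C | ∀ u ∈ F, ⟪v, u⟫ = 1}

/-- The positive hull: `pos(X) = {λx | λ ≥ 0, x ∈ X}` for nonempty `X`, and `pos ∅ = {0}`. -/
def posHull {n : ℕ} (X : Set (Eu n)) : Set (Eu n) :=
  {w | w = 0 ∨ ∃ l : ℝ, 0 ≤ l ∧ ∃ x ∈ X, w = l • x}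

def e₁ : Eu 2 := EuclideanSpace.single 0 1

/-- The closed upper half-plane. -/
def Hplus : Set (Eu 2) := {p | 0 ≤ p 1}

/-- The closed lower half-plane. -/
def Hminus : Set (Eu 2) := {p | p 1 ≤ 0}


/-- conjugate face inside `K`. -/
def cj (K : Set (Eu 2)) (v : Eu 2) : Set (Eu 2) := {w | w ∈ K ∧ ⟪v, w⟫ = -1}

lemma ip (x y : Eu 2) : ⟪x, y⟫ = x 0 * y 0 + x 1 * y 1 := by
  simp [PiLp.inner_apply, Fin.sum_univ_two]; ring

lemma eu_ext {x y : Eu 2} (h0 : x 0 = y 0) (h1 : x 1 = y 1) : x = y := by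
  ext i; fin_cases i <;> assumption

lemma uniq {p q c x : Eu 2} (hpq : p ≠ q) (h1 : ⟪c, p⟫ = -1) (h2 : ⟪c, q⟫ = -1)
    (h3 : ⟪x, p⟫ = -1) (h4 : ⟪x, q⟫ = -1) : x = c := by
  rw [ip] at *
  have key : (x 0 - c 0) * c 1 - (x 1 - c 1) * c 0 = 0 := by
    by_contra h
    apply hpq
    apply eu_ext
    · apply mul_left_cancel₀ h
      linear_combination (c 1) * (h3 - h1 - h4 + h2) - (x 1 - c 1) * (h1 - h2)
    · apply mul_left_cancel₀ h
      linear_combination -(c 0) * (h3 - h1 - h4 + h2) + (x 0 - c 0) * (h1 - h2)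
  apply eu_ext
  · linear_combination (x 0 - c 0) * h1 - (c 0) * (h3 - h1) - p 1 * key
  · linear_combination (x 1 - c 1) * h1 - (c 1) * (h3 - h1) + p 0 * key

/-- orientation determinant -/
def dt (a b c : Eu 2) : ℝ := (b 0 - a 0) * (c 1 - a 1) - (b 1 - a 1) * (c 0 - a 0)

section
variable {K : Set (Eu 2)} (hK : IsCompact K) (hconv : Convex ℝ K) (hsd : dualSet K = K)

lemma ge_neg_one (hsd : dualSet K = K) {x y : Eu 2} (hx : x ∈ K) (hy : y ∈ K) : -1 ≤ ⟪x, y⟫ := by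
  rw [← hsd] at hx
  have := hx y hy
  linarith

lemma cj_symm {x y : Eu 2} (hx : x ∈ K) (h : y ∈ cj K x) : x ∈ cj K y :=
  ⟨hx, by rw [real_inner_comm]; exact h.2⟩

lemma small_ball_mem (hK : IsCompact K) (hsd : dualSet K = K) :
    ∃ r > 0, ∀ x : Eu 2, ‖x‖ ≤ r → x ∈ K := by
  obtain ⟨M, hM0, hM⟩ := hK.isBounded.exists_pos_norm_le
  refine ⟨1 / M, by positivity, fun x hx => ?_⟩
  rw [← hsd]
  intro v hv
  have h1 := abs_real_inner_le_norm x v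
  have h2 : ‖x‖ * ‖v‖ ≤ 1 / M * M := by
    gcongr
    exact hM v hv
  have h3 : 1 / M * M = 1 := by field_simp
  have := neg_abs_le ⟪x, v⟫
  linarith

lemma cj_open (hsd : dualSet K = K) {v x z y : Eu 2} (hv : v ∈ K) (hx : x ∈ K) (hz : z ∈ K)
    (hy : ⟪v, y⟫ = -1) (h : y ∈ openSegment ℝ x z) : ⟪v, x⟫ = -1 ∧ ⟪v, z⟫ = -1 := by
  obtain ⟨a, b, ha, hb, hab, rfl⟩ := h
  have h1 := ge_neg_one hsd hv hx
  have h2 := ge_neg_one hsd hv hz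
  rw [inner_add_right, inner_smul_right, inner_smul_right] at hy
  have hb' : b = 1 - a := by linarith
  subst hb'
  constructor <;> nlinarith

lemma cj_face (hconv : Convex ℝ K) (hsd : dualSet K = K) {v : Eu 2} (hv : v ∈ K) :
    IsFace K (cj K v) := by
  refine ⟨fun x hx => hx.1, ?_, ?_⟩
  · intro x hx y hy a b ha hb hab
    refine ⟨hconv hx.1 hy.1 ha hb hab, ?_⟩
    rw [inner_add_right, inner_smul_right, inner_smul_right, hx.2, hy.2]
    linarith
  · intro x hx z hz y hy h
    have := cj_open hsd hv hx hz hy.2 h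
    exact ⟨⟨hx, this.1⟩, ⟨hz, this.2⟩⟩

lemma line_coord {v p w : Eu 2} (hp : ⟪v, p⟫ = -1) (hw : ⟪v, w⟫ = -1) :
    ∃ r : ℝ, w 0 = p 0 + r * (-v 1) ∧ w 1 = p 1 + r * v 0 := by
  rw [ip] at *
  have hv : v 0 ^ 2 + v 1 ^ 2 ≠ 0 := by
    intro h
    have h0 : v 0 = 0 := by nlinarith [sq_nonneg (v 0), sq_nonneg (v 1)]
    have h1 : v 1 = 0 := by nlinarith [sq_nonneg (v 0), sq_nonneg (v 1)]
    rw [h0, h1] at hp; norm_num at hp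
  refine ⟨((w 1 - p 1) * v 0 - (w 0 - p 0) * v 1) / (v 0 ^ 2 + v 1 ^ 2), ?_, ?_⟩
  · field_simp
    linear_combination (v 0) * (hw - hp)
  · field_simp
    linear_combination (v 1) * (hw - hp)

lemma cj_collinear (v : Eu 2) : Collinear ℝ (cj K v) := by
  rcases (cj K v).eq_empty_or_nonempty with h | ⟨p, hp⟩
  · rw [h]; exact collinear_empty ℝ _
  · rw [collinear_iff_of_mem hp]
    refine ⟨!₂[-v 1, v 0], fun w hw => ?_⟩
    obtain ⟨r, h0, h1⟩ := line_coord hp.2 hw.2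
    exact ⟨r, eu_ext (by simp [h0]; ring) (by simp [h1]; ring)⟩

lemma cj_finrank {v : Eu 2} (hn : (cj K v).Nontrivial) :
    Module.finrank ℝ (affineSpan ℝ (cj K v)).direction = 1 := by
  rw [direction_affineSpan]
  have h1 := collinear_iff_finrank_le_one.1 (cj_collinear (K := K) v)
  have h2 : Module.finrank ℝ (vectorSpan ℝ (cj K v)) ≠ 0 := by
    intro h
    rw [Submodule.finrank_eq_zero, vectorSpan_eq_bot_iff_subsingleton] at h
    exact Set.not_subsingleton_iff.2 hn h
  omega

lemma face_eq_cj (hK : IsCompact K) (hsd : dualSet K = K) {s : Set (Eu 2)}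
    (hs : IsFace K s) (hf : Module.finrank ℝ (affineSpan ℝ s).direction = 1) :
    ∃ c ∈ K, s = cj K c ∧ s.Nontrivial := by
  rw [direction_affineSpan] at hf
  have hcol : Collinear ℝ s := collinear_iff_finrank_le_one.2 hf.le
  have hnt : s.Nontrivial := by
    by_contra h
    rw [Set.not_nontrivial_iff] at h
    have := (vectorSpan_eq_bot_iff_subsingleton (k := ℝ)).2 h
    rw [this] at hf
    simp at hf
  obtain ⟨hsK, hsc, hsf⟩ := hs
  obtain ⟨r, hr, hball⟩ := small_ball_mem hK hsd
  have h0 : (0 : Eu 2) ∉ s := by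
    intro h0
    have hin : ∀ x : Eu 2, ‖x‖ ≤ r → x ∈ s := by
      intro x hx
      refine (hsf x (hball x hx) (-x) (hball _ (by simpa using hx)) 0 h0 ?_).1
      exact ⟨1/2, 1/2, by norm_num, by norm_num, by norm_num, by simp⟩
    obtain ⟨w, hw⟩ := (collinear_iff_of_mem h0).1 hcol
    obtain ⟨r1, h1⟩ := hw (EuclideanSpace.single 0 r) (hin _ (by simp [abs_of_pos hr]))
    obtain ⟨r2, h2⟩ := hw (EuclideanSpace.single 1 r) (hin _ (by simp [abs_of_pos hr]))
    have e1 := congrArg (fun z : Eu 2 => z 0) h1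
    have e2 := congrArg (fun z : Eu 2 => z 1) h1
    have e3 := congrArg (fun z : Eu 2 => z 0) h2
    have e4 := congrArg (fun z : Eu 2 => z 1) h2
    simp at e1 e2 e3 e4
    rcases e2 with h | h
    · rw [h] at e1; linarith
    · rw [h] at e4; linarith
  have hnon : K.Nonempty := ⟨_, hsK hnt.nonempty.some_mem⟩
  have hc : ∀ m ∈ s, ∃ c ∈ K, ⟪m, c⟫ = -1 := by
    intro m hm
    have hm0 : m ≠ 0 := fun h => h0 (h ▸ hm)
    obtain ⟨c, hcK, hmin⟩ := hK.exists_isMinOn hnon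
      (f := fun c => ⟪m, c⟫) (by fun_prop)
    refine ⟨c, hcK, ?_⟩
    by_contra hne
    have hge := ge_neg_one hsd (hsK hm) hcK
    have hgt : -1 < ⟪m, c⟫ := lt_of_le_of_ne hge (Ne.symm hne)
    have hneg : ⟪m, c⟫ < 0 := by
      have hmn : 0 < ‖m‖ := norm_pos_iff.2 hm0
      have hk : (-(r / ‖m‖)) • m ∈ K := by
        apply hball
        rw [norm_smul, norm_neg, Real.norm_of_nonneg (by positivity)]
        field_simp
        exact le_rfl
      have h1 : ⟪m, c⟫ ≤ ⟪m, (-(r / ‖m‖)) • m⟫ := hmin hk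
      rw [inner_smul_right, real_inner_self_eq_norm_sq] at h1
      have : 0 < r / ‖m‖ * ‖m‖ ^ 2 := by positivity
      linarith
    set μ := ⟪m, c⟫ with hμ
    have hz : (1 / (-μ)) • m ∈ K := by
      rw [← hsd]
      intro v hv
      have h1 : μ ≤ ⟪m, v⟫ := hmin hv
      rw [inner_smul_left]
      simp only [conj_trivial]
      have hp : 0 < -μ := by linarith
      have : 0 ≤ 1 / (-μ) * (⟪m, v⟫ - μ) := by
        apply mul_nonneg
        · positivity
        · linarith
      have e : 1 / (-μ) * (⟪m, v⟫ - μ) = 1 + 1 / (-μ) * ⟪m, v⟫ := by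
        have hμ0 : μ ≠ 0 := by linarith
        field_simp
        ring
      linarith
    apply h0
    refine (hsf 0 (hball 0 (by simpa using hr.le)) _ hz m hm ?_).1
    refine ⟨1 + μ, -μ, by linarith, by linarith, by ring, ?_⟩
    rw [smul_zero, zero_add, smul_smul, mul_one_div_cancel (by linarith), one_smul]
  obtain ⟨p, hp, q, hq, hpq⟩ := hnt
  set m : Eu 2 := (1/2 : ℝ) • p + (1/2 : ℝ) • q with hmdef
  have hm : m ∈ s := hsc hp hq (by norm_num) (by norm_num) (by norm_num)
  obtain ⟨c, hcK, hmc⟩ := hc m hm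
  rw [real_inner_comm] at hmc
  have hcpq := cj_open hsd hcK (hsK hp) (hsK hq) hmc
    ⟨1/2, 1/2, by norm_num, by norm_num, by norm_num, rfl⟩
  refine ⟨c, hcK, ?_, ⟨p, hp, q, hq, hpq⟩⟩
  apply Set.Subset.antisymm
  · intro x hx
    refine ⟨hsK hx, ?_⟩
    obtain ⟨w, hw⟩ := (collinear_iff_of_mem hp).1 hcol
    obtain ⟨rq, hrq⟩ := hw q hq
    obtain ⟨rx, hrx⟩ := hw x hx
    have hrq0 : rq ≠ 0 := by
      rintro rfl
      apply hpq; rw [hrq]; simp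
    have e := hcpq.2
    rw [hrq, vadd_eq_add, inner_add_right, inner_smul_right, hcpq.1] at e
    have : ⟪c, w⟫ = 0 := by
      apply mul_left_cancel₀ hrq0; linarith
    rw [hrx, vadd_eq_add, inner_add_right, inner_smul_right, hcpq.1, this]
    ring
  · intro y hy
    obtain ⟨w, hw⟩ := (collinear_iff_of_mem (p₀ := p) (⟨hsK hp, hcpq.1⟩ : p ∈ cj K c)).1
      (cj_collinear (K := K) c)
    obtain ⟨rq, hrq⟩ := hw q ⟨hsK hq, hcpq.2⟩
    obtain ⟨ry, hry⟩ := hw y hy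
    have hrq0 : rq ≠ 0 := by
      rintro rfl
      apply hpq; rw [hrq]; simp
    -- y = p + t (q - p)
    set t := ry / rq with ht
    have hyt : y = p + t • (q - p) := by
      rw [hry, hrq, vadd_eq_add, vadd_eq_add, add_sub_cancel_right, smul_smul, ht,
        div_mul_cancel₀ _ hrq0, add_comm]
    -- z = m - ε (t - 1/2)(q - p)
    have habs : 0 < 1 + |t| := by positivity
    set ε : ℝ := 1 / (4 * (1 + |t|)) with hε
    have hε0 : 0 < ε := by positivity
    have hεt : ε * (1 + |t|) = 1 / 4 := by rw [hε]; field_simp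
    have hb1 : ε * (t - 1/2) ≤ 1/4 := by
      have := mul_le_mul_of_nonneg_left (by linarith [le_abs_self t] : t - 1/2 ≤ 1 + |t|) hε0.le
      linarith
    have hb2 : -(1/4) ≤ ε * (t - 1/2) := by
      have := mul_le_mul_of_nonneg_left
        (by linarith [neg_abs_le t] : -(1 + |t|) ≤ t - 1/2) hε0.le
      linarith
    set z : Eu 2 := (1/2 + ε * (t - 1/2)) • p + (1/2 - ε * (t - 1/2)) • q with hz
    have hzs : z ∈ s := hsc hp hq (by linarith) (by linarith) (by ring)
    refine (hsf y hy.1 z (hsK hzs) m hm ?_).1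
    refine ⟨ε / (1 + ε), 1 / (1 + ε), by positivity, by positivity, by field_simp; ring, ?_⟩
    have h1 : (1 + ε) ≠ 0 := by positivity
    rw [hyt, hz, hmdef]
    apply eu_ext <;> simp <;> field_simp <;> ring

lemma cj_ends (hK : IsCompact K) (hsd : dualSet K = K) {v : Eu 2}
    (hv : v ∈ K) (hn : (cj K v).Nontrivial) :
    ∃ a b, a ≠ b ∧ a ∈ cj K v ∧ b ∈ cj K v ∧ a ∈ extremePoints ℝ K ∧ b ∈ extremePoints ℝ K ∧
      ∀ w ∈ cj K v, w ∈ extremePoints ℝ K → w = a ∨ w = b := by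
  have hcomp : IsCompact (cj K v) := by
    apply hK.inter_right (t := {w | ⟪v, w⟫ = -1})
    exact isClosed_eq (by fun_prop) (by fun_prop)
  set g : Eu 2 → ℝ := fun w => w 1 * v 0 - w 0 * v 1 with hg
  have hgc : ContinuousOn g (cj K v) := by
    apply Continuous.continuousOn; rw [hg]; fun_prop
  have ginj : ∀ x y : Eu 2, ⟪v, x⟫ = -1 → ⟪v, y⟫ = -1 → g x = g y → x = y := by
    intro x y hx hy hxy
    obtain ⟨r, h0, h1⟩ := line_coord hx hy
    simp only [hg, h0, h1] at hxy
    have hv0 : r * (v 0 ^ 2 + v 1 ^ 2) = 0 := by linarith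
    rcases mul_eq_zero.1 hv0 with h | h
    · subst h; exact eu_ext (by rw [h0]; ring) (by rw [h1]; ring)
    · have a0 : v 0 = 0 := by nlinarith [sq_nonneg (v 0), sq_nonneg (v 1)]
      have a1 : v 1 = 0 := by nlinarith [sq_nonneg (v 0), sq_nonneg (v 1)]
      rw [ip, a0, a1] at hx; norm_num at hx
  have glin : ∀ (x y : Eu 2) (s t : ℝ), g (s • x + t • y) = s * g x + t * g y := by
    intro x y s t; simp [hg]; ring
  obtain ⟨a, ha, hamin⟩ := hcomp.exists_isMinOn hn.nonempty hgc
  obtain ⟨b, hb, hbmax⟩ := hcomp.exists_isMaxOn hn.nonempty hgc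
  have hab : a ≠ b := by
    rintro rfl
    obtain ⟨x, hx, y, hy, hxy⟩ := hn
    apply hxy
    apply ginj x y hx.2 hy.2
    have h1 : g a ≤ g x := hamin hx
    have h2 : g a ≤ g y := hamin hy
    have h3 : g x ≤ g a := hbmax hx
    have h4 : g y ≤ g a := hbmax hy
    linarith
  refine ⟨a, b, hab, ha, hb, ⟨ha.1, ?_⟩, ⟨hb.1, ?_⟩, ?_⟩
  · intro x hx z hz h
    have h' := cj_open hsd hv hx hz ha.2 h
    have h1 : g a ≤ g x := hamin ⟨hx, h'.1⟩
    have h2 : g a ≤ g z := hamin ⟨hz, h'.2⟩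
    apply ginj x a h'.1 ha.2
    obtain ⟨s, t, hs, ht, hst, e⟩ := h
    have e2 := congrArg g e
    rw [glin] at e2
    have : t = 1 - s := by linarith
    subst this
    nlinarith
  · intro x hx z hz h
    have h' := cj_open hsd hv hx hz hb.2 h
    have h1 : g x ≤ g b := hbmax ⟨hx, h'.1⟩
    have h2 : g z ≤ g b := hbmax ⟨hz, h'.2⟩
    apply ginj x b h'.1 hb.2
    obtain ⟨s, t, hs, ht, hst, e⟩ := h
    have e2 := congrArg g e
    rw [glin] at e2
    have : t = 1 - s := by linarith
    subst this
    nlinarith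
  · intro w hw hwe
    by_contra hcon
    push Not at hcon
    have h1 : g a ≤ g w := hamin hw
    have h2 : g w ≤ g b := hbmax hw
    have h1' : g a < g w := lt_of_le_of_ne h1 fun h => hcon.1 (ginj w a hw.2 ha.2 h.symm)
    have h2' : g w < g b := lt_of_le_of_ne h2 fun h => hcon.2 (ginj w b hw.2 hb.2 h)
    have hpos : 0 < g b - g a := by linarith
    apply hcon.1
    symm
    refine hwe.2 ha.1 hb.1 ⟨(g b - g w) / (g b - g a), (g w - g a) / (g b - g a),
      div_pos (by linarith) hpos, div_pos (by linarith) hpos, by field_simp; ring, ?_⟩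
    apply ginj _ _ _ hw.2
    · rw [glin]; field_simp; ring
    · rw [inner_add_right, inner_smul_right, inner_smul_right, ha.2, hb.2]; field_simp; ring

lemma cj_extreme (hsd : dualSet K = K) {v : Eu 2} (hv : v ∈ K) (hn : (cj K v).Nontrivial) :
    v ∈ extremePoints ℝ K := by
  obtain ⟨p, hp, q, hq, hpq⟩ := hn
  refine ⟨hv, fun x hx z hz h => ?_⟩
  have h1 := cj_open hsd hp.1 hx hz (by rw [real_inner_comm]; exact hp.2) h
  have h2 := cj_open hsd hq.1 hx hz (by rw [real_inner_comm]; exact hq.2) h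
  exact uniq hpq hp.2 hq.2 (by rw [real_inner_comm]; exact h1.1)
    (by rw [real_inner_comm]; exact h2.1)

lemma exposed_pt (hK : IsCompact K) (hsd : dualSet K = K) {a b : Eu 2} (hb : b ∈ K) (hab : a ≠ b)
    (h : IsExposedFace K {a}) : ∃ c ∈ K, cj K c = {a} := by
  obtain ⟨r, hr, hball⟩ := small_ball_mem hK hsd
  rcases h with h | h | ⟨u, hu, h⟩
  · simp at h
  · rw [← h] at hb; exact absurd hb.symm hab
  · have hbdd : BddAbove ((fun x => ⟪x, u⟫) '' K) :=
      (hK.image (by fun_prop)).bddAbove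
    have hle : ∀ x ∈ K, ⟪x, u⟫ ≤ supp K u := fun x hx => le_csSup hbdd ⟨x, hx, rfl⟩
    have hpos : 0 < supp K u := by
      have hun : 0 < ‖u‖ := norm_pos_iff.2 hu
      have hk : (r / ‖u‖) • u ∈ K := by
        apply hball
        rw [norm_smul, Real.norm_of_nonneg (by positivity)]
        field_simp
        exact le_rfl
      have h1 := hle _ hk
      rw [inner_smul_left, real_inner_self_eq_norm_sq] at h1
      simp only [conj_trivial] at h1
      have : 0 < r / ‖u‖ * ‖u‖ ^ 2 := by positivity
      linarith
    set H := supp K u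
    have hform : ∀ x : Eu 2, ⟪(-(1 / H)) • u, x⟫ = - (⟪x, u⟫ / H) := by
      intro x
      rw [inner_smul_left, real_inner_comm]
      simp only [conj_trivial]
      ring
    refine ⟨(-(1 / H)) • u, ?_, ?_⟩
    · rw [← hsd]
      intro v hv
      rw [hform]
      have := (div_le_one hpos).2 (hle v hv)
      linarith
    · rw [h]
      ext x
      constructor
      · rintro ⟨h1, h2⟩
        refine ⟨h1, ?_⟩
        rw [hform] at h2
        have : ⟪x, u⟫ / H = 1 := by linarith
        rw [div_eq_one_iff_eq hpos.ne'] at this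
        exact this
      · rintro ⟨h1, h2⟩
        refine ⟨h1, ?_⟩
        rw [hform, h2, div_self hpos.ne']

lemma cj_W (hK : IsCompact K) (hsd : dualSet K = K)
    (hnoexp : ∀ x ∈ Set.extremePoints ℝ K, IsExposedFace K {x})
    {v a b : Eu 2} (hv : v ∈ K) (ha : a ∈ cj K v) (hb : b ∈ cj K v) (hab : a ≠ b)
    (hae : a ∈ extremePoints ℝ K) : (cj K a).Nontrivial := by
  obtain ⟨c, hc, hca⟩ := exposed_pt hK hsd hb.1 hab (hnoexp a hae)
  refine ⟨v, cj_symm hv ha, c, cj_symm hc (by rw [hca]; rfl), ?_⟩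
  rintro rfl
  rw [hca] at hb
  exact hab hb.symm

lemma hull_eq (hK : IsCompact K) (hconv : Convex ℝ K) (W : Finset (Eu 2)) (hWn : W.Nonempty)
    (hWK : ∀ w ∈ W, w ∈ K) (hsd : dualSet K = K)
    (hW : ∀ v ∈ W, ∃ a ∈ W, ∃ b ∈ W, a ≠ b ∧ ⟪v, a⟫ = -1 ∧ ⟪v, b⟫ = -1) :
    K = convexHull ℝ (W : Set (Eu 2)) := by
  apply Set.Subset.antisymm
  · intro x hx
    by_contra hxn
    obtain ⟨f, u, hf1, hf2⟩ := geometric_hahn_banach_closed_point (convex_convexHull ℝ _)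
      (W.finite_toSet.isClosed_convexHull ℝ) hxn
    obtain ⟨v, hv, hmax⟩ := W.exists_max_image f hWn
    have hvu : f v < u := hf1 v (subset_convexHull ℝ _ hv)
    obtain ⟨c, hc, d, hd, hcd, hvc, hvd⟩ := hW v hv
    have oth : ∀ c ∈ W, ∃ w ∈ W, w ≠ v ∧ ⟪c, w⟫ = -1 := by
      intro c hc
      obtain ⟨a, ha, b, hb, hab, h1, h2⟩ := hW c hc
      by_cases h : a = v
      · exact ⟨b, hb, fun h' => hab (h.trans h'.symm), h2⟩
      · exact ⟨a, ha, h, h1⟩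
    obtain ⟨w1, hw1, hw1v, hcw1⟩ := oth c hc
    obtain ⟨w2, hw2, hw2v, hdw2⟩ := oth d hd
    have pos1 : 0 < 1 + ⟪d, w1⟫ := by
      have := ge_neg_one hsd (hWK d hd) (hWK w1 hw1)
      rcases this.lt_or_eq with h | h
      · linarith
      · exact absurd (uniq hcd hvc hvd (by rw [real_inner_comm]; exact hcw1)
          (by rw [real_inner_comm]; exact h.symm)) hw1v
    have pos2 : 0 < 1 + ⟪c, w2⟫ := by
      have := ge_neg_one hsd (hWK c hc) (hWK w2 hw2)
      rcases this.lt_or_eq with h | h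
      · linarith
      · exact absurd (uniq hcd hvc hvd (by rw [real_inner_comm]; exact h.symm)
          (by rw [real_inner_comm]; exact hdw2)) hw2v
    have hxc := ge_neg_one hsd (hWK c hc) hx
    have hxd := ge_neg_one hsd (hWK d hd) hx
    set s := (1 + ⟪d, x⟫) / (1 + ⟪d, w1⟫) with hs
    set t := (1 + ⟪c, x⟫) / (1 + ⟪c, w2⟫) with ht
    have hs0 : 0 ≤ s := div_nonneg (by linarith) pos1.le
    have ht0 : 0 ≤ t := div_nonneg (by linarith) pos2.le
    have hs1 : s * (1 + ⟪d, w1⟫) = 1 + ⟪d, x⟫ := div_mul_cancel₀ _ pos1.ne'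
    have ht1 : t * (1 + ⟪c, w2⟫) = 1 + ⟪c, x⟫ := div_mul_cancel₀ _ pos2.ne'
    have key : x - s • (w1 - v) - t • (w2 - v) = v := by
      apply uniq hcd hvc hvd
      · rw [real_inner_comm]
        rw [real_inner_comm] at hvc
        simp only [inner_sub_right, inner_smul_right, hvc, hcw1]
        linarith
      · rw [real_inner_comm]
        rw [real_inner_comm] at hvd
        simp only [inner_sub_right, inner_smul_right, hvd, hdw2]
        linarith
    have e := congrArg f key
    simp only [map_sub, map_smul, smul_eq_mul] at e
    have m1 := hmax w1 hw1
    have m2 := hmax w2 hw2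
    nlinarith
  · exact convexHull_min (fun w hw => hWK w hw) hconv

lemma noncomb (hconv : Convex ℝ K) {a b c d : Eu 2} (ha : a ∈ K) (hb : b ∈ K) (hc : c ∈ K)
    (hd : d ∈ extremePoints ℝ K) (had : a ≠ d) (hbd : b ≠ d) (hcd : c ≠ d) {α β γ : ℝ}
    (hα : 0 ≤ α) (hβ : 0 ≤ β) (hγ : 0 ≤ γ) (hne : 0 < α + β + γ)
    (h0 : α * a 0 + β * b 0 + γ * c 0 = (α + β + γ) * d 0)
    (h1 : α * a 1 + β * b 1 + γ * c 1 = (α + β + γ) * d 1) : False := by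
  have hcv := (hconv.mem_extremePoints_iff_convex_sdiff.1 hd).2
  have := hcv.sum_mem (t := Finset.univ) (w := ![α / (α + β + γ), β / (α + β + γ), γ / (α + β + γ)])
    (z := ![a, b, c]) (by intro i _; fin_cases i <;> simp <;> positivity)
    (by simp [Fin.sum_univ_three]; field_simp)
    (by intro i _; fin_cases i <;> simp [*])
  apply this.2
  simp only [Fin.sum_univ_three, mem_singleton_iff]
  apply eu_ext
  · simp; field_simp; linarith
  · simp; field_simp; linarith

lemma dt_ne (hconv : Convex ℝ K) {a b c : Eu 2} (ha : a ∈ extremePoints ℝ K)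
    (hb : b ∈ extremePoints ℝ K)
    (hc : c ∈ extremePoints ℝ K) (hab : a ≠ b) (hac : a ≠ c) (hbc : b ≠ c) : dt a b c ≠ 0 := by
  intro h
  -- c = a + t (b - a)
  obtain ⟨t, h0, h1⟩ : ∃ t : ℝ, c 0 = a 0 + t * (b 0 - a 0) ∧ c 1 = a 1 + t * (b 1 - a 1) := by
    unfold dt at h
    by_cases hx : b 0 - a 0 = 0
    · have hy : b 1 - a 1 ≠ 0 := fun hy => hab (eu_ext (by linarith) (by linarith))
      refine ⟨(c 1 - a 1) / (b 1 - a 1), ?_, ?_⟩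
      · rw [hx] at h ⊢
        have : (b 1 - a 1) * (c 0 - a 0) = 0 := by linarith
        have := (mul_eq_zero.1 this).resolve_left hy
        linarith
      · field_simp; ring
    · refine ⟨(c 0 - a 0) / (b 0 - a 0), ?_, ?_⟩
      · field_simp; ring
      · field_simp; linarith
  rcases le_total t 0 with ht | ht
  · -- a between c and b : (1-t) a = c - t b
    refine noncomb hconv (α := 1) (β := -t) (γ := 0) hc.1 hb.1 hb.1 ha hac.symm hab.symm hab.symm
      (by norm_num) (by linarith) le_rfl (by linarith) ?_ ?_
    · rw [h0]; ring
    · rw [h1]; ring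
  · rcases le_total t 1 with ht1 | ht1
    · refine noncomb hconv (α := 1 - t) (β := t) (γ := 0) ha.1 hb.1 hb.1 hc hac hbc hbc
        (by linarith) (by linarith) le_rfl (by linarith) ?_ ?_
      · rw [h0]; ring
      · rw [h1]; ring
    · refine noncomb hconv (α := 1) (β := t - 1) (γ := 0) hc.1 ha.1 ha.1 hb hbc.symm hab hab
        (by linarith) (by linarith) le_rfl (by linarith) ?_ ?_
      · rw [h0]; ring
      · rw [h1]; ring

lemma cross_aux (hsd : dualSet K = K) {a b c d : Eu 2} (ha : a ∈ K) (hb : b ∈ K) (hc : c ∈ K)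
    (hd : d ∈ K) (hab : ⟪a, b⟫ = -1) (hcd : ⟪c, d⟫ = -1) (hne : a ≠ d) {α β γ δ : ℝ}
    (hα : 0 < α) (hβ : 0 ≤ β) (hγ : 0 ≤ γ) (hδ : 0 ≤ δ) (hs : α - β + γ - δ = 0)
    (h0 : α * a 0 - β * b 0 + γ * c 0 - δ * d 0 = 0)
    (h1 : α * a 1 - β * b 1 + γ * c 1 - δ * d 1 = 0) : False := by
  have e1 := ge_neg_one hsd ha hc
  have e2 := ge_neg_one hsd hb hd
  rw [ip] at *
  have k1 : 0 ≤ α * γ * (1 + (a 0 * c 0 + a 1 * c 1)) := by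
    apply mul_nonneg (by positivity); linarith
  have k2 : 0 ≤ β * δ * (1 + (b 0 * d 0 + b 1 * d 1)) := by
    apply mul_nonneg (by positivity); linarith
  have key : (α - δ) ^ 2 + (α * a 0 - δ * d 0) ^ 2 + (α * a 1 - δ * d 1) ^ 2 =
      - (α * γ * (1 + (a 0 * c 0 + a 1 * c 1))) - β * δ * (1 + (b 0 * d 0 + b 1 * d 1)) := by
    linear_combination (α - δ) * hs + (α * a 0 - δ * d 0) * h0 + (α * a 1 - δ * d 1) * h1
      + α * β * hab + γ * δ * hcd
  have s1 := sq_nonneg (α - δ)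
  have s2 := sq_nonneg (α * a 0 - δ * d 0)
  have s3 := sq_nonneg (α * a 1 - δ * d 1)
  have z1 : α - δ = 0 := by apply pow_eq_zero_iff (two_ne_zero) |>.1; linarith
  have z2 : α * a 0 - δ * d 0 = 0 := by apply pow_eq_zero_iff (two_ne_zero) |>.1; linarith
  have z3 : α * a 1 - δ * d 1 = 0 := by apply pow_eq_zero_iff (two_ne_zero) |>.1; linarith
  have : δ = α := by linarith
  subst this
  apply hne
  apply eu_ext
  · apply mul_left_cancel₀ hα.ne'; linarith
  · apply mul_left_cancel₀ hα.ne'; linarith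

lemma cross_aux2 (hconv : Convex ℝ K) (hsd : dualSet K = K) {a b c d : Eu 2}
    (ha : a ∈ extremePoints ℝ K) (hb : b ∈ extremePoints ℝ K) (hc : c ∈ extremePoints ℝ K)
    (hd : d ∈ extremePoints ℝ K) (hab : ⟪a, b⟫ = -1) (hcd : ⟪c, d⟫ = -1)
    (hac : a ≠ c) (had : a ≠ d) (hbc : b ≠ c) (hbd : b ≠ d) (hncd : c ≠ d) {α β γ δ : ℝ}
    (hγ : 0 < γ) (hδ : 0 < δ) (hs : α + β + γ - δ = 0)
    (h0 : α * a 0 + β * b 0 + γ * c 0 - δ * d 0 = 0)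
    (h1 : α * a 1 + β * b 1 + γ * c 1 - δ * d 1 = 0) : False := by
  have hba : ⟪b, a⟫ = -1 := by rw [real_inner_comm]; exact hab
  have hdc : ⟪d, c⟫ = -1 := by rw [real_inner_comm]; exact hcd
  rcases le_or_gt α 0 with hα | hα
  · rcases le_or_gt β 0 with hβ | hβ
    · -- c combination
      refine noncomb hconv (α := -α) (β := -β) (γ := δ) ha.1 hb.1 hd.1 hc hac hbc hncd.symm
        (by linarith) (by linarith) hδ.le (by linarith) ?_ ?_
      · rw [show -α + -β + δ = γ by linarith]; linarith
      · rw [show -α + -β + δ = γ by linarith]; linarith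
    · refine cross_aux hsd (α := β) (β := -α) (γ := γ) (δ := δ) hb.1 ha.1 hc.1 hd.1 hba hcd hbd hβ
        (by linarith) hγ.le hδ.le ?_ ?_ ?_ <;> linarith
  · rcases le_or_gt β 0 with hβ | hβ
    · refine cross_aux hsd (α := α) (β := -β) (γ := γ) (δ := δ) ha.1 hb.1 hc.1 hd.1 hab hcd had hα
        (by linarith) hγ.le hδ.le ?_ ?_ ?_ <;> linarith
    · refine noncomb hconv (α := α) (β := β) (γ := γ) ha.1 hb.1 hc.1 hd had hbd hncd
        hα.le hβ.le hγ.le (by linarith) ?_ ?_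
      · rw [show α + β + γ = δ by linarith]; linarith
      · rw [show α + β + γ = δ by linarith]; linarith

lemma cross (hconv : Convex ℝ K) (hsd : dualSet K = K) {a b c d : Eu 2}
    (ha : a ∈ extremePoints ℝ K) (hb : b ∈ extremePoints ℝ K) (hc : c ∈ extremePoints ℝ K)
    (hd : d ∈ extremePoints ℝ K) (hab : ⟪a, b⟫ = -1) (hcd : ⟪c, d⟫ = -1)
    (hac : a ≠ c) (had : a ≠ d) (hbc : b ≠ c) (hbd : b ≠ d) (hnab : a ≠ b) (hncd : c ≠ d) :
    dt a b c * dt a b d < 0 := by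
  have n1 := dt_ne hconv ha hb hc hnab hac hbc
  have n2 := dt_ne hconv ha hb hd hnab had hbd
  by_contra hcon
  push Not at hcon
  have hpos : 0 < dt a b c * dt a b d := lt_of_le_of_ne hcon (mul_ne_zero n1 n2).symm
  rcases pos_and_pos_or_neg_and_neg_of_mul_pos hpos with ⟨p1, p2⟩ | ⟨p1, p2⟩
  · refine cross_aux2 hconv hsd (α := dt b c d) (β := - dt a c d) (γ := dt a b d) (δ := dt a b c)
      ha hb hc hd hab hcd hac had hbc hbd hncd p2 p1 ?_ ?_ ?_ <;> unfold dt <;> ring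
  · refine cross_aux2 hconv hsd (α := - dt b c d) (β := dt a c d) (γ := -dt a b d)
      (δ := - dt a b c)
      ha hb hc hd hab hcd hac had hbc hbd hncd (by linarith) (by linarith) ?_ ?_ ?_ <;>
      unfold dt <;> ring

end

/-- counting lemma -/
lemma count {α : Type*} [DecidableEq α] (L R : Finset α) (p q p' q' : α) (r : α → α → Prop)
    [DecidableRel r] (hsymm : ∀ x y, r x y → r y x) (W : Finset α)
    (hW : ∀ x, x ∈ W ↔ x = p ∨ x = q ∨ x ∈ L ∨ x ∈ R)
    (hpq : p ≠ q) (hpL : p ∉ L) (hpR : p ∉ R) (hqL : q ∉ L) (hqR : q ∉ R) (hLR : Disjoint L R)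
    (hdeg : ∀ x ∈ W, (W.filter (r x)).card = 2)
    (hL : ∀ x ∈ L, ∀ y ∈ L, ¬ r x y) (hR : ∀ x ∈ R, ∀ y ∈ R, ¬ r x y)
    (hp' : p' ∈ L) (hq' : q' ∈ L)
    (hp : ∀ x ∈ W, r p x ↔ x = q ∨ x = p') (hq : ∀ x ∈ W, r q x ↔ x = p ∨ x = q') :
    Odd W.card ∧ 3 ≤ W.card := by
  have hWeq : W = insert p (insert q (L ∪ R)) := by
    ext x; rw [hW]; simp
  have hcard : W.card = L.card + R.card + 2 := by
    rw [hWeq, Finset.card_insert_of_notMem (by simp [*]), Finset.card_insert_of_notMem (by simp [*]),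
      Finset.card_union_of_disjoint hLR]
  have hLW : ∀ x ∈ L, x ∈ W := fun x hx => (hW x).2 (by tauto)
  have hRW : ∀ x ∈ R, x ∈ W := fun x hx => (hW x).2 (by tauto)
  have e1 : ∑ x ∈ L, (Finset.bipartiteAbove r R x).card = ∑ y ∈ R, (Finset.bipartiteBelow r L y).card :=
    Finset.sum_card_bipartiteAbove_eq_sum_card_bipartiteBelow r
  have e2 : ∑ y ∈ R, (Finset.bipartiteBelow r L y).card = 2 * R.card := by
    rw [Finset.sum_congr rfl (g := fun _ => 2)]
    · simp [mul_comm]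
    · intro y hy
      rw [← hdeg y (hRW y hy)]
      congr 1
      ext x
      simp only [Finset.bipartiteBelow, Finset.mem_filter]
      constructor
      · rintro ⟨h1, h2⟩; exact ⟨hLW x h1, hsymm _ _ h2⟩
      · rintro ⟨h1, h2⟩
        refine ⟨?_, hsymm _ _ h2⟩
        rcases (hW x).1 h1 with rfl | rfl | h | h
        · have := (hp y (hRW y hy)).1 (hsymm _ _ h2)
          rcases this with rfl | rfl
          · exact absurd hy hqR
          · exact absurd hy (Finset.disjoint_left.1 hLR hp')
        · have := (hq y (hRW y hy)).1 (hsymm _ _ h2)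
          rcases this with rfl | rfl
          · exact absurd hy hpR
          · exact absurd hy (Finset.disjoint_left.1 hLR hq')
        · exact h
        · exact absurd h2 (hR y hy x h)
  have e3 : ∀ x ∈ L, 2 = (Finset.bipartiteAbove r R x).card + (if x = p' then 1 else 0)
      + (if x = q' then 1 else 0) := by
    intro x hx
    rw [← hdeg x (hLW x hx)]
    have : W.filter (r x) = Finset.bipartiteAbove r R x ∪ (if x = p' then {p} else ∅) ∪
        (if x = q' then {q} else ∅) := by
      ext y
      have hxq : x ≠ q := fun h => hqL (h ▸ hx)
      have hxp : x ≠ p := fun h => hpL (h ▸ hx)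
      have a1 : x = p' ↔ r p x := by rw [hp x (hLW x hx)]; tauto
      have a2 : x = q' ↔ r q x := by rw [hq x (hLW x hx)]; tauto
      simp only [Finset.bipartiteAbove, Finset.mem_filter, Finset.mem_union, a1, a2, hW y]
      constructor
      · rintro ⟨rfl | rfl | h | h, h2⟩
        · simp [hsymm _ _ h2]
        · simp [hsymm _ _ h2]
        · exact absurd h2 (hL x hx y h)
        · simp [h, h2]
      · rintro ((h | h) | h)
        · tauto
        · split_ifs at h with h3
          · rw [Finset.mem_singleton.1 h]; exact ⟨Or.inl rfl, hsymm _ _ h3⟩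
          · simp at h
        · split_ifs at h with h3
          · rw [Finset.mem_singleton.1 h]; exact ⟨Or.inr (Or.inl rfl), hsymm _ _ h3⟩
          · simp at h
    rw [this, Finset.card_union_of_disjoint, Finset.card_union_of_disjoint]
    · split_ifs <;> simp
    · rw [Finset.disjoint_left]; intro y hy
      simp only [Finset.bipartiteAbove, Finset.mem_filter] at hy
      split_ifs
      · simp; rintro rfl; exact hpR hy.1
      · simp
    · rw [Finset.disjoint_left]; intro y hy
      have : y ≠ q := by
        rintro rfl
        rcases Finset.mem_union.1 hy with hy | hy
        · simp only [Finset.bipartiteAbove, Finset.mem_filter] at hy; exact hqR hy.1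
        · split_ifs at hy
          · exact hpq (Finset.mem_singleton.1 hy).symm
          · simp at hy
      split_ifs
      · simpa using this
      · simp
  have e4 := Finset.sum_congr rfl e3
  rw [Finset.sum_add_distrib, Finset.sum_add_distrib, e1, e2, Finset.sum_ite_eq' L p',
    Finset.sum_ite_eq' L q'] at e4
  simp [hp', hq'] at e4
  refine ⟨⟨R.card + 1, by omega⟩, by omega⟩

lemma main_count {K : Set (Eu 2)} (hconv : Convex ℝ K) (hsd : dualSet K = K)
    (W : Finset (Eu 2)) (hWn : W.Nonempty) (hWe : ∀ w ∈ W, w ∈ extremePoints ℝ K)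
    (hW : ∀ v ∈ W, ∃ a ∈ W, ∃ b ∈ W, a ≠ b ∧ ∀ w ∈ W, ⟪v, w⟫ = -1 ↔ w = a ∨ w = b) :
    Odd W.card ∧ 3 ≤ W.card := by
  classical
  have irr : ∀ x : Eu 2, ⟪x, x⟫ ≠ -1 := by
    intro x h
    have := real_inner_self_nonneg (x := x)
    linarith
  have irr' : ∀ x y : Eu 2, ⟪x, y⟫ = -1 → x ≠ y := by
    rintro x y h rfl; exact irr x h
  have other : ∀ v ∈ W, ∀ a ∈ W, ⟪v, a⟫ = -1 → ∃ b ∈ W, a ≠ b ∧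
      ∀ w ∈ W, ⟪v, w⟫ = -1 ↔ w = a ∨ w = b := by
    intro v hv a ha hva
    obtain ⟨x, hx, y, hy, hxy, h⟩ := hW v hv
    rcases (h a ha).1 hva with rfl | rfl
    · exact ⟨y, hy, hxy, h⟩
    · exact ⟨x, hx, hxy.symm, fun w hw => by rw [h w hw, or_comm]⟩
  obtain ⟨p, hp⟩ := hWn
  obtain ⟨q, hq, q1, hq1, hqq1, h⟩ := hW p hp
  have hpq : ⟪p, q⟫ = -1 := (h q hq).2 (Or.inl rfl)
  have hqp : ⟪q, p⟫ = -1 := by rw [real_inner_comm]; exact hpq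
  clear h hqq1
  obtain ⟨p', hp', hqp', hpn⟩ := other p hp q hq hpq
  obtain ⟨q', hq', hpq', hqn⟩ := other q hq p hp hqp
  have hpp' : ⟪p, p'⟫ = -1 := (hpn p' hp').2 (Or.inr rfl)
  have hqq' : ⟪q, q'⟫ = -1 := (hqn q' hq').2 (Or.inr rfl)
  have npq := irr' _ _ hpq
  have npp' := irr' _ _ hpp'
  have nqq' := irr' _ _ hqq'
  have hd : ∀ x ∈ W, x ≠ p → x ≠ q → dt p q x ≠ 0 := fun x hx h1 h2 =>
    dt_ne hconv (hWe p hp) (hWe q hq) (hWe x hx) npq h1.symm h2.symm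
  have hp0 : dt p q p = 0 := by unfold dt; ring
  have hq0 : dt p q q = 0 := by unfold dt; ring
  have hdeg : ∀ x ∈ W, (W.filter (fun y => ⟪x, y⟫ = -1)).card = 2 := by
    intro x hx
    obtain ⟨a, ha, b, hb, hab, h⟩ := hW x hx
    refine Eq.trans ?_ (Finset.card_pair hab)
    congr 1
    ext w
    simp only [Finset.mem_filter, Finset.mem_insert, Finset.mem_singleton]
    constructor
    · rintro ⟨h1, h2⟩; exact (h w h1).1 h2
    · intro h1
      have hw : w ∈ W := by rcases h1 with rfl | rfl <;> assumption
      exact ⟨hw, (h w hw).2 h1⟩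
  have hcr : ∀ x ∈ W, ∀ y ∈ W, dt p q x ≠ 0 → dt p q y ≠ 0 → ⟪x, y⟫ = -1 →
      dt p q x * dt p q y < 0 := by
    intro x hx y hy hx0 hy0 hxy
    refine cross hconv hsd (hWe p hp) (hWe q hq) (hWe x hx) (hWe y hy) hpq hxy ?_ ?_ ?_ ?_ npq
      (irr' _ _ hxy)
    all_goals rintro rfl; first | exact hx0 hp0 | exact hx0 hq0 | exact hy0 hp0 | exact hy0 hq0
  have hsame : 0 < dt p q p' * dt p q q' := by
    by_cases hpe : p' = q'
    · rw [← hpe]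
      have := hd p' hp' npp'.symm hqp'.symm
      exact mul_self_pos.2 this
    · have c1 := cross hconv hsd (hWe p hp) (hWe p' hp') (hWe q hq) (hWe q' hq') hpp' hqq'
        npq hpq' hqp'.symm hpe npp' nqq'
      have c2 := cross hconv hsd (hWe q hq) (hWe q' hq') (hWe p hp) (hWe p' hp') hqq' hpp'
        npq.symm hqp' hpq'.symm (Ne.symm hpe) nqq' npp'
      have r1 : dt p q p' = - dt p p' q := by unfold dt; ring
      have r2 : dt p q q' = dt q q' p := by unfold dt; ring
      have r3 : dt q q' p' = dt q q' p - dt p p' q' + dt p p' q := by unfold dt; ring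
      rw [r1, r2]
      rw [r3] at c2
      by_contra hcon
      push Not at hcon
      rcases lt_or_gt_of_ne (show dt p p' q ≠ 0 by rintro h; rw [h] at c1; simp at c1) with h | h
      · have a1 : 0 < dt p p' q' := by nlinarith
        have a2 : dt q q' p ≤ 0 := by nlinarith
        have := mul_nonneg_of_nonpos_of_nonpos a2
          (show dt q q' p - dt p p' q' + dt p p' q ≤ 0 by linarith)
        linarith
      · have a1 : dt p p' q' < 0 := by nlinarith
        have a2 : 0 ≤ dt q q' p := by nlinarith
        have := mul_nonneg a2 (show 0 ≤ dt q q' p - dt p p' q' + dt p p' q by linarith)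
        linarith
  have hsy : ∀ x y : Eu 2, ⟪x, y⟫ = -1 → ⟪y, x⟫ = -1 := by
    intro x y h; rw [real_inner_comm]; exact h
  have fin : ∀ σ : ℝ, σ ≠ 0 → 0 < σ * dt p q p' → 0 < σ * dt p q q' → Odd W.card ∧ 3 ≤ W.card := by
    intro σ hσ h1 h2
    refine count (W.filter (fun x => 0 < σ * dt p q x)) (W.filter (fun x => σ * dt p q x < 0))
      p q p' q' (fun x y => ⟪x, y⟫ = -1) hsy W ?_ npq (by simp [hp0]) (by simp [hp0])
      (by simp [hq0]) (by simp [hq0]) ?_ hdeg ?_ ?_ (by simp [hp', h1]) (by simp [hq', h2]) hpn hqn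
    · intro x
      simp only [Finset.mem_filter]
      constructor
      · intro hx
        by_cases e1 : x = p
        · exact Or.inl e1
        by_cases e2 : x = q
        · exact Or.inr (Or.inl e2)
        rcases lt_or_gt_of_ne (mul_ne_zero hσ (hd x hx e1 e2)) with h | h
        · exact Or.inr (Or.inr (Or.inr ⟨hx, h⟩))
        · exact Or.inr (Or.inr (Or.inl ⟨hx, h⟩))
      · rintro (rfl | rfl | h | h)
        · exact hp
        · exact hq
        · exact h.1
        · exact h.1
    · rw [Finset.disjoint_left]
      intro x hx hy
      have a1 := (Finset.mem_filter.1 hx).2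
      have a2 := (Finset.mem_filter.1 hy).2
      linarith
    · intro x hx y hy hxy
      obtain ⟨hx, hx1⟩ := Finset.mem_filter.1 hx
      obtain ⟨hy, hy1⟩ := Finset.mem_filter.1 hy
      have := hcr x hx y hy (right_ne_zero_of_mul hx1.ne') (right_ne_zero_of_mul hy1.ne') hxy
      have h3 := mul_pos hx1 hy1
      have h4 : 0 < σ * σ := mul_self_pos.2 hσ
      nlinarith
    · intro x hx y hy hxy
      obtain ⟨hx, hx1⟩ := Finset.mem_filter.1 hx
      obtain ⟨hy, hy1⟩ := Finset.mem_filter.1 hy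
      have := hcr x hx y hy (right_ne_zero_of_mul hx1.ne) (right_ne_zero_of_mul hy1.ne) hxy
      have h3 := mul_pos_of_neg_of_neg hx1 hy1
      have h4 : 0 < σ * σ := mul_self_pos.2 hσ
      nlinarith
  rcases pos_and_pos_or_neg_and_neg_of_mul_pos hsame with ⟨h1, h2⟩ | ⟨h1, h2⟩
  · exact fin 1 one_ne_zero (by linarith) (by linarith)
  · exact fin (-1) (by norm_num) (by linarith) (by linarith)

/-- a planar self-dual convex body with finitely many segments, at least
one segment, and no non-exposed points, is a polytope with an odd number (at least 3)
of segments. -/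
theorem stmt19 (K : Set (Eu 2)) (hK : IsCompact K) (hconv : Convex ℝ K)
    (hsd : dualSet K = K)
    (hfin : {s : Set (Eu 2) | IsFace K s ∧
      Module.finrank ℝ (affineSpan ℝ s).direction = 1}.Finite)
    (hne : {s : Set (Eu 2) | IsFace K s ∧
      Module.finrank ℝ (affineSpan ℝ s).direction = 1}.Nonempty)
    (hnoexp : ∀ x ∈ Set.extremePoints ℝ K, IsExposedFace K {x}) :
    (∃ V : Finset (Eu 2), K = convexHull ℝ (V : Set (Eu 2))) ∧
    Odd (Nat.card {s : Set (Eu 2) | IsFace K s ∧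
      Module.finrank ℝ (affineSpan ℝ s).direction = 1}) ∧
    3 ≤ Nat.card {s : Set (Eu 2) | IsFace K s ∧
      Module.finrank ℝ (affineSpan ℝ s).direction = 1} := by
  classical
  set S : Set (Set (Eu 2)) := {s : Set (Eu 2) | IsFace K s ∧
      Module.finrank ℝ (affineSpan ℝ s).direction = 1} with hS
  set W : Set (Eu 2) := {v | v ∈ K ∧ (cj K v).Nontrivial} with hWdef
  have hbij : Set.BijOn (cj K) W S := by
    refine ⟨?_, ?_, ?_⟩
    · rintro v ⟨hv, hn⟩
      exact ⟨cj_face hconv hsd hv, cj_finrank hn⟩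
    · rintro v ⟨hv, p, hp, q, hq, hpq⟩ w ⟨hw, hn⟩ h
      have hp' := hp
      have hq' := hq
      rw [h] at hp' hq'
      exact uniq hpq hp'.2 hq'.2 hp.2 hq.2
    · rintro s ⟨hs, hf⟩
      obtain ⟨c, hc, rfl, hn⟩ := face_eq_cj hK hsd hs hf
      exact ⟨c, ⟨hc, hn⟩, rfl⟩
  have hWfin : W.Finite := (hbij.finite_iff_finite).2 hfin
  have hcard : Nat.card S = hWfin.toFinset.card := by
    rw [← Nat.card_congr (hbij.equiv), Nat.card_coe_set_eq, Set.ncard_eq_toFinset_card W hWfin]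
  have hWn : hWfin.toFinset.Nonempty := by
    obtain ⟨s, hs⟩ := hne
    obtain ⟨v, hv, -⟩ := hbij.surjOn hs
    exact ⟨v, by simpa using hv⟩
  have hWe : ∀ w ∈ hWfin.toFinset, w ∈ extremePoints ℝ K := by
    intro w hw
    rw [Set.Finite.mem_toFinset] at hw
    exact cj_extreme hsd hw.1 hw.2
  have hW : ∀ v ∈ hWfin.toFinset, ∃ a ∈ hWfin.toFinset, ∃ b ∈ hWfin.toFinset, a ≠ b ∧
      ∀ w ∈ hWfin.toFinset, ⟪v, w⟫ = -1 ↔ w = a ∨ w = b := by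
    intro v hv
    rw [Set.Finite.mem_toFinset] at hv
    obtain ⟨a, b, hab, ha, hb, hae, hbe, h⟩ := cj_ends hK hsd hv.1 hv.2
    refine ⟨a, ?_, b, ?_, hab, ?_⟩
    · rw [Set.Finite.mem_toFinset]
      exact ⟨ha.1, cj_W hK hsd hnoexp hv.1 ha hb hab hae⟩
    · rw [Set.Finite.mem_toFinset]
      exact ⟨hb.1, cj_W hK hsd hnoexp hv.1 hb ha hab.symm hbe⟩
    · intro w hw
      constructor
      · intro h1
        exact h w ⟨(hWe w hw).1, h1⟩ (hWe w hw)
      · rintro (rfl | rfl)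
        · exact ha.2
        · exact hb.2
  refine ⟨⟨hWfin.toFinset, ?_⟩, ?_⟩
  · apply hull_eq hK hconv _ hWn (fun w hw => (hWe w hw).1) hsd
    intro v hv
    obtain ⟨a, ha, b, hb, hab, h⟩ := hW v hv
    exact ⟨a, ha, b, hb, hab, (h a ha).2 (Or.inl rfl), (h b hb).2 (Or.inr rfl)⟩
  · rw [hcard]
    exact main_count hconv hsd _ hWn hWe hW
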